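/- Let X and Y be infinite dimensional Banach spaces and T : X → Y a continuous linear surjection. Then there exist a constant η > 0, a continuous map τ : Y → X, and a set B ⊆ Y such that: τ is positively homogeneous (τ(λy) = λ·τ(y) for all λ ≥ 0 and y ∈ Y); T ∘ τ = id_Y; B is dense in Y; B is meager in Y; and τ is pointwise η-Lipschitz at every point of B. -/

import Mathlib

open Filter Metric Set

/-- `f` is pointwise `α`-Lipschitz at `b`:
`limsup_{r→0⁺} ( r⁻¹ · sup { d(f b, f a) : a ∈ closedBall b r } ) ≤ α`. -/
noncomputable def PtwiseLipschitzAt {M X : Type*} [PseudoMetricSpace M] [PseudoMetricSpace X]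
    (f : M → X) (α : ℝ) (b : M) : Prop :=
  Filter.limsup
    (fun r : ℝ => (ENNReal.ofReal r)⁻¹ * ⨆ a ∈ Metric.closedBall b r, edist (f b) (f a))
    (nhdsWithin 0 (Set.Ioi 0)) ≤ ENNReal.ofReal α

open Topology

/-- Maximal separated subsets. -/
lemma exists_sep {Y : Type*} [MetricSpace Y] (A : Set Y) (ε : ℝ) :
    ∃ S ⊆ A, (S.Pairwise fun x y => ε ≤ dist x y) ∧ (0 < ε → ∀ a ∈ A, ∃ s ∈ S, dist a s < ε) := by
  obtain ⟨S, hS⟩ := zorn_subset {S : Set Y | S ⊆ A ∧ S.Pairwise fun x y => ε ≤ dist x y} (by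
    intro c hc hchain
    refine ⟨⋃₀ c, ⟨?_, ?_⟩, fun s hs => Set.subset_sUnion_of_mem hs⟩
    · exact Set.sUnion_subset fun s hs => (hc hs).1
    · exact (Set.pairwise_sUnion hchain.directedOn).2 fun s hs => (hc hs).2)
  refine ⟨S, hS.prop.1, hS.prop.2, ?_⟩
  intro hε a ha
  by_contra! hcon
  have hmem : insert a S ∈ {S : Set Y | S ⊆ A ∧ S.Pairwise fun x y => ε ≤ dist x y} := by
    refine ⟨Set.insert_subset ha hS.prop.1, ?_⟩
    refine hS.prop.2.insert ?_
    intro b hb _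
    exact ⟨hcon b hb, by rw [dist_comm]; exact hcon b hb⟩
  have := hS.le_of_ge hmem (Set.subset_insert a S) (Set.mem_insert a S)
  have h2 := hcon a this
  rw [dist_self] at h2
  linarith

lemma limit_lemma {X Y : Type*} [NormedAddCommGroup X] [CompleteSpace X]
    [TopologicalSpace Y] (u : ℕ → Y → X) (hu : ∀ n, Continuous (u n)) (C : Y → ℝ)
    (hC : Continuous C) (h : ∀ n y, dist (u n y) (u (n+1) y) ≤ C y / 2 / 2 ^ n) :
    ∃ g : Y → X, Continuous g ∧ ∀ y, Tendsto (fun n => u n y) atTop (𝓝 (g y)) := by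
  have hc : ∀ y, ∃ x, Tendsto (fun n => u n y) atTop (𝓝 x) := fun y =>
    cauchySeq_tendsto_of_complete (cauchySeq_of_le_geometric_two (fun n => h n y))
  choose g hg using hc
  refine ⟨g, ?_, hg⟩
  have hb : ∀ y n, dist (u n y) (g y) ≤ C y / 2 ^ n := fun y n =>
    dist_le_of_le_geometric_two_of_tendsto (fun n => h n y) (hg y) n
  have : TendstoLocallyUniformly u g atTop := by
    rw [Metric.tendstoLocallyUniformly_iff]
    intro ε hε y
    refine ⟨{z | C z < C y + 1}, (isOpen_lt hC continuous_const).mem_nhds (by simp), ?_⟩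
    have h1 : Tendsto (fun n : ℕ => (C y + 1) * (1/2 : ℝ) ^ n) atTop (𝓝 ((C y + 1) * 0)) :=
      (tendsto_pow_atTop_nhds_zero_of_lt_one (by norm_num) (by norm_num)).const_mul _
    rw [mul_zero] at h1
    filter_upwards [h1.eventually (gt_mem_nhds hε)] with n hn z hz
    rw [dist_comm]
    refine (hb z n).trans_lt (lt_of_le_of_lt ?_ hn)
    rw [one_div, inv_pow, ← div_eq_mul_inv]
    have : C z ≤ C y + 1 := le_of_lt hz
    gcongr
  exact this.continuous (Frequently.of_forall hu)

section
variable {X Y : Type*} [NormedAddCommGroup X] [NormedSpace ℝ X] [CompleteSpace X]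
    [NormedAddCommGroup Y] [NormedSpace ℝ Y]

lemma approx_sel [CompleteSpace Y] (T : X →L[ℝ] Y) (hT : Function.Surjective T) :
    ∃ C : ℝ, 0 < C ∧ ∃ g : Y → X, Continuous g ∧ (∀ y, ‖g y‖ ≤ C * ‖y‖) ∧
      ∀ y, ‖y - T (g y)‖ ≤ 1 / 2 * ‖y‖ := by
  obtain ⟨C, C0, hC⟩ := T.exists_preimage_norm_le hT
  let t : {y : Y // y ≠ 0} → Set X := fun y =>
    {x | ‖x‖ < (C + 1) * ‖(y : Y)‖} ∩ {x | ‖(y : Y) - T x‖ < 1 / 2 * ‖(y : Y)‖}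
  obtain ⟨g, hg⟩ := exists_continuous_forall_mem_convex_of_local_const (t := t) (by
      intro y
      refine Convex.inter ?_ ?_
      · have := convex_ball (0 : X) ((C + 1) * ‖(y : Y)‖)
        convert this using 1
        ext x; simp
      · have := (convex_ball (y : Y) (1 / 2 * ‖(y : Y)‖)).linear_preimage T.toLinearMap
        convert this using 1
        ext x; simp [dist_eq_norm, norm_sub_rev]) (by
      intro y
      obtain ⟨x, hx, hxn⟩ := hC y
      have hy : 0 < ‖(y : Y)‖ := norm_pos_iff.2 y.2
      refine ⟨x, ?_⟩
      have h1 : ∀ᶠ z : {y : Y // y ≠ 0} in 𝓝 y, ‖x‖ < (C + 1) * ‖(z : Y)‖ := by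
        refine (isOpen_lt (by fun_prop) (by fun_prop)).mem_nhds ?_
        change ‖x‖ < (C + 1) * ‖(y : Y)‖
        nlinarith
      have h2 : ∀ᶠ z : {y : Y // y ≠ 0} in 𝓝 y, ‖(z : Y) - T x‖ < 1 / 2 * ‖(z : Y)‖ := by
        refine (isOpen_lt (by fun_prop) (by fun_prop)).mem_nhds ?_
        change ‖(y : Y) - T x‖ < 1 / 2 * ‖(y : Y)‖
        rw [hx, sub_self, norm_zero]; positivity
      filter_upwards [h1, h2] with z a b using ⟨a, b⟩)
  classical
  let G : Y → X := fun y => if h : y ≠ 0 then g ⟨y, h⟩ else 0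
  have hGn : ∀ y, ‖G y‖ ≤ (C + 1) * ‖y‖ := by
    intro y
    by_cases h : y ≠ 0
    · simp only [G, dif_pos h]
      exact (hg ⟨y, h⟩).1.le
    · simp only [G, dif_neg h, norm_zero]; positivity
  refine ⟨C + 1, by positivity, G, ?_, hGn, ?_⟩
  · rw [continuous_iff_continuousAt]
    intro y
    by_cases h : y = 0
    · subst h
      have h0 : G 0 = 0 := by simp [G]
      rw [ContinuousAt, h0]
      refine squeeze_zero_norm hGn ?_
      have : Continuous fun y : Y => (C + 1) * ‖y‖ := by fun_prop
      simpa using this.tendsto 0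
    · have ho : IsOpen {y : Y | y ≠ 0} := isOpen_ne
      have : ContinuousOn G {y : Y | y ≠ 0} := by
        rw [continuousOn_iff_continuous_domRestrict]
        refine g.continuous.congr fun z => ?_
        have hz : (z : Y) ≠ 0 := z.2
        change g z = G z
        simp only [G, dif_pos hz]
      exact this.continuousAt (ho.mem_nhds h)
  · intro y
    by_cases h : y ≠ 0
    · simp only [G, dif_pos h]
      exact (hg ⟨y, h⟩).2.le
    · push Not at h
      simp [G, h]

lemma bartle_graves [CompleteSpace Y] (T : X →L[ℝ] Y) (hT : Function.Surjective T) :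
    ∃ M : ℝ, 0 < M ∧ ∃ g : Y → X, Continuous g ∧ (∀ y, ‖g y‖ ≤ M * ‖y‖) ∧
      ∀ y, T (g y) = y := by
  obtain ⟨C, C0, g, hg, hgn, hgT⟩ := approx_sel T hT
  let u : ℕ → Y → X := fun n => Nat.rec (fun _ => 0) (fun _ v y => v y + g (y - T (v y))) n
  have us : ∀ n y, u (n + 1) y = u n y + g (y - T (u n y)) := fun n y => rfl
  have u0 : ∀ y, u 0 y = 0 := fun y => rfl
  have huc : ∀ n, Continuous (u n) := by
    intro n
    induction n with
    | zero => exact continuous_const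
    | succ n ih =>
      have : u (n + 1) = fun y => u n y + g (y - T (u n y)) := rfl
      rw [this]
      fun_prop
  have hr : ∀ n y, ‖y - T (u n y)‖ ≤ ‖y‖ * (1 / 2) ^ n := by
    intro n y
    induction n with
    | zero => simp [u0]
    | succ n ih =>
      rw [us, map_add, ← sub_sub]
      refine (hgT _).trans ?_
      rw [pow_succ]; linarith
  have hd : ∀ n y, dist (u n y) (u (n + 1) y) ≤ (2 * C * ‖y‖) / 2 / 2 ^ n := by
    intro n y
    rw [us, dist_self_add_right]
    refine (hgn _).trans ?_
    have := mul_le_mul_of_nonneg_left (hr n y) C0.le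
    refine this.trans (le_of_eq ?_)
    rw [one_div, inv_pow]; field_simp
  obtain ⟨σ, hσ, hlim⟩ := limit_lemma u huc (fun y => 2 * C * ‖y‖) (by fun_prop) hd
  refine ⟨2 * C, by positivity, σ, hσ, ?_, ?_⟩
  · intro y
    have := dist_le_of_le_geometric_two_of_tendsto₀ (fun n => hd n y) (hlim y)
    rwa [u0, dist_zero_left] at this
  · intro y
    have h1 : Tendsto (fun n => y - T (u n y)) atTop (𝓝 (y - T (σ y))) :=
      tendsto_const_nhds.sub ((T.continuous.tendsto _).comp (hlim y))
    have h2 : Tendsto (fun n => y - T (u n y)) atTop (𝓝 0) := by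
      refine squeeze_zero_norm (fun n => hr n y) ?_
      have := (tendsto_pow_atTop_nhds_zero_of_lt_one (r := (1/2 : ℝ)) (by norm_num)
        (by norm_num)).const_mul ‖y‖
      simpa using this
    exact (sub_eq_zero.1 (tendsto_nhds_unique h1 h2)).symm

lemma step_lemma (T : X →L[ℝ] Y) {M : ℝ} {σ : Y → X} (hσ : Continuous σ)
    (hσn : ∀ y, ‖σ y‖ ≤ M * ‖y‖) (hσT : ∀ y, T (σ y) = y)
    (F E : Set Y) (hF : IsClosed F) (hEF : ∀ b ∈ E, b ∉ F) {ε : ℝ} (hε : 0 < ε)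
    (hE : E.Pairwise fun x y => ε ≤ dist x y) {δ : ℝ} (hδ : 0 < δ)
    (f : Y → X) (hf : Continuous f) (hfT : ∀ y, T (f y) = y) :
    ∃ f' : Y → X, Continuous f' ∧ (∀ y, T (f' y) = y) ∧ (∀ y, dist (f y) (f' y) ≤ δ) ∧
      (∀ y, ∀ d ∈ F, dist (f y) (f' y) ≤ δ * ‖y - d‖) ∧
      ∀ b ∈ E, ∀ᶠ y in 𝓝 b, ‖f' y - f' b‖ ≤ M * ‖y - b‖ := by
  have hσ0 : σ 0 = 0 := by
    have := hσn 0
    simpa using this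
  have hr : ∀ b : E, ∃ r > 0, r ≤ ε / 4 ∧ ∀ y : Y, dist y b < r →
      ‖f b + σ (y - b) - f y‖ ≤ δ ∧ ∀ d ∈ F, ‖f b + σ (y - b) - f y‖ ≤ δ * ‖y - d‖ := by
    intro b
    obtain ⟨ρ, hρ, hρF⟩ := Metric.isOpen_iff.1 hF.isOpen_compl b (hEF b b.2)
    have hcont : Continuous fun y => ‖f b + σ (y - b) - f y‖ := by fun_prop
    have hpos : 0 < δ * min 1 (ρ / 2) := by positivity
    have : ∀ᶠ y in 𝓝 (b : Y), ‖f b + σ (y - b) - f y‖ < δ * min 1 (ρ / 2) := by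
      refine (isOpen_lt hcont continuous_const).mem_nhds ?_
      simpa [hσ0] using hpos
    obtain ⟨r, hr, hrb⟩ := Metric.eventually_nhds_iff.1 this
    refine ⟨min r (min (ε / 4) (ρ / 2)), by positivity,
      (min_le_right _ _).trans (min_le_left _ _), ?_⟩
    intro y hy
    have h1 := (hrb (hy.trans_le (min_le_left _ _))).le
    have h2 : dist y b < ρ / 2 :=
      hy.trans_le ((min_le_right _ _).trans (min_le_right _ _))
    constructor
    · refine h1.trans ?_
      have := mul_le_mul_of_nonneg_left (min_le_left (1 : ℝ) (ρ / 2)) hδ.le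
      linarith
    · intro d hd
      refine h1.trans (mul_le_mul_of_nonneg_left ?_ hδ.le)
      refine (min_le_right _ _).trans ?_
      rw [← dist_eq_norm]
      by_contra! hlt
      have : d ∈ Metric.ball (b : Y) ρ := by
        rw [Metric.mem_ball]
        have := dist_triangle d y b
        rw [dist_comm d y] at this
        linarith
      exact hρF this hd
  choose r hr0 hrε hrb using hr
  let φ : E → Y → ℝ := fun b y => max 0 (min 1 (2 - 2 * dist y b / r b))
  have hφ0 : ∀ b y, 0 ≤ φ b y := fun b y => le_max_left _ _
  have hφ1 : ∀ b y, φ b y ≤ 1 := fun b y => max_le zero_le_one (min_le_left _ _)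
  have hφout : ∀ (b : E) (y : Y), r b ≤ dist y b → φ b y = 0 := by
    intro b y h
    have : 2 - 2 * dist y b / r b ≤ 0 := by
      rw [sub_nonpos, le_div_iff₀ (hr0 b)]; linarith
    exact max_eq_left ((min_le_right _ _).trans this)
  have hφin : ∀ (b : E) (y : Y), dist y b ≤ r b / 2 → φ b y = 1 := by
    intro b y h
    have : 1 ≤ 2 - 2 * dist y b / r b := by
      rw [le_sub_comm, div_le_iff₀ (hr0 b)]; linarith
    simp only [φ]
    rw [min_eq_left this, max_eq_right zero_le_one]
  have hφc : ∀ b, Continuous (φ b) := by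
    intro b
    simp only [φ]
    fun_prop
  let t : E → Y → X := fun b y => φ b y • (f b + σ (y - b) - f y)
  have htc : ∀ b, Continuous (t b) := by
    intro b
    have := hφc b
    simp only [t]
    fun_prop
  have htout : ∀ (b : E) (y : Y), r b ≤ dist y b → t b y = 0 := by
    intro b y h
    simp [t, hφout b y h]
  have huniq : ∀ (b c : E) (y z : Y), dist y b < r b → dist z c < r c → dist y z < ε / 2 →
      b = c := by
    intro b c y z h1 h2 h3
    by_contra hne
    have := hE b.2 c.2 (fun h => hne (Subtype.ext h))
    have h4 := dist_triangle4 (b : Y) y z c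
    rw [dist_comm (b : Y) y] at h4
    have := hrε b
    have := hrε c
    linarith
  have hlf : LocallyFinite fun b => Function.support (t b) := by
    intro y
    refine ⟨Metric.ball y (ε / 4), Metric.ball_mem_nhds _ (by positivity), ?_⟩
    refine Set.Subsingleton.finite ?_
    rintro b ⟨y1, hy1, hy1'⟩ c ⟨z1, hz1, hz1'⟩
    refine huniq b c y1 z1 ?_ ?_ ?_
    · by_contra! h; exact hy1 (htout b y1 h)
    · by_contra! h; exact hz1 (htout c z1 h)
    · have := dist_triangle_right y1 z1 y
      rw [Metric.mem_ball] at hy1' hz1'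
      linarith
  let Δ : Y → X := fun y => ∑ᶠ b, t b y
  have hΔc : Continuous Δ := continuous_finsum htc hlf
  have hΔin : ∀ (b : E) (y : Y), dist y b < r b → Δ y = t b y := by
    intro b y h
    refine finsum_eq_single _ b ?_
    intro c hc
    refine htout c y ?_
    by_contra! h'
    exact hc (huniq c b y y h' h (by rw [dist_self]; positivity))
  have hΔout : ∀ y : Y, (∀ b : E, r b ≤ dist y b) → Δ y = 0 := by
    intro y h
    simp only [Δ]
    rw [← finsum_zero (α := E)]
    exact finsum_congr fun b => htout b y (h b)
  have hcase : ∀ y : Y, Δ y = 0 ∨ ∃ b : E, dist y b < r b ∧ Δ y = t b y := by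
    intro y
    by_cases h : ∀ b : E, r b ≤ dist y b
    · exact Or.inl (hΔout y h)
    · push Not at h
      obtain ⟨b, hb⟩ := h
      exact Or.inr ⟨b, hb, hΔin b y hb⟩
  have htn : ∀ b y, ‖t b y‖ ≤ ‖f b + σ (y - b) - f y‖ := by
    intro b y
    simp only [t]
    rw [norm_smul, Real.norm_of_nonneg (hφ0 b y)]
    exact mul_le_of_le_one_left (norm_nonneg _) (hφ1 b y)
  refine ⟨fun y => f y + Δ y, hf.add hΔc, ?_, ?_, ?_, ?_⟩
  · intro y
    rcases hcase y with h | ⟨b, hb, h⟩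
    · simp [h, hfT]
    · simp [h, t, hfT, hσT]
  · intro y
    rw [dist_self_add_right]
    rcases hcase y with h | ⟨b, hb, h⟩
    · simp [h, hδ.le]
    · rw [h]; exact (htn b y).trans (hrb b y hb).1
  · intro y d hd
    rw [dist_self_add_right]
    rcases hcase y with h | ⟨b, hb, h⟩
    · rw [h, norm_zero]; positivity
    · rw [h]; exact (htn b y).trans ((hrb b y hb).2 d hd)
  · intro b hb
    have key : ∀ y, dist y b < r ⟨b, hb⟩ / 2 → f y + Δ y = f b + σ (y - b) := by
      intro y hy
      have h0 := hr0 ⟨b, hb⟩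
      rw [hΔin ⟨b, hb⟩ y (by change dist y b < _; linarith)]
      simp only [t]
      rw [hφin ⟨b, hb⟩ y hy.le]
      simp
    filter_upwards [Metric.ball_mem_nhds b (half_pos (hr0 ⟨b, hb⟩))] with y hy
    rw [key y hy, key b (by rw [dist_self]; exact half_pos (hr0 _))]
    simpa [hσ0] using hσn (y - b)

lemma main_sel (T : X →L[ℝ] Y) {M : ℝ} (hM : 0 < M) {σ : Y → X} (hσ : Continuous σ)
    (hσn : ∀ y, ‖σ y‖ ≤ M * ‖y‖) (hσT : ∀ y, T (σ y) = y)
    (S : ℕ → Set Y) (ε : ℕ → ℝ) (hε : ∀ n, 0 < ε n)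
    (hS : ∀ n, (S n).Pairwise fun x y => ε n ≤ dist x y) :
    ∃ g : Y → X, Continuous g ∧ (∀ y, T (g y) = y) ∧ (∀ y, ‖g y‖ ≤ M * ‖y‖ + 2) ∧
      ∀ n, ∀ b ∈ S n, ∀ᶠ y in 𝓝 b, ‖g y - g b‖ ≤ (M + 2) * ‖y - b‖ := by
  let F : ℕ → Set Y := fun n => ⋃ k ∈ Set.Iio n, S k
  have hF : ∀ n, IsClosed (F n) := fun n =>
    (Set.finite_Iio n).isClosed_biUnion fun k _ => Metric.isClosed_of_pairwise_le_dist (hε k) (hS k)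
  have hstep : ∀ n (f : {f : Y → X // Continuous f ∧ ∀ y, T (f y) = y}),
      ∃ f' : {f : Y → X // Continuous f ∧ ∀ y, T (f y) = y},
      (∀ y, dist (f.1 y) (f'.1 y) ≤ 1 / 2 ^ n) ∧
      (∀ y, ∀ d ∈ F n, dist (f.1 y) (f'.1 y) ≤ 1 / 2 ^ n * ‖y - d‖) ∧
      ∀ b ∈ S n \ F n, ∀ᶠ y in 𝓝 b, ‖f'.1 y - f'.1 b‖ ≤ M * ‖y - b‖ := by
    intro n f
    obtain ⟨f', h1, h2, h3⟩ := step_lemma T hσ hσn hσT (F n) (S n \ F n) (hF n) (fun b hb => hb.2)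
      (hε n) ((hS n).mono Set.sdiff_subset) (δ := 1 / 2 ^ n) (by positivity) f.1 f.2.1 f.2.2
    exact ⟨⟨f', h1, h2⟩, h3⟩
  choose st hst1 hst2 hst3 using hstep
  let v : ℕ → {f : Y → X // Continuous f ∧ ∀ y, T (f y) = y} :=
    fun n => Nat.rec ⟨σ, hσ, hσT⟩ (fun n f => st n f) n
  let u : ℕ → Y → X := fun n => (v n).1
  have u0 : ∀ y, u 0 y = σ y := fun y => rfl
  have hd : ∀ n y, dist (u n y) (u (n + 1) y) ≤ 2 / 2 / 2 ^ n := by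
    intro n y
    rw [div_self two_ne_zero]
    exact hst1 n (v n) y
  have hd2 : ∀ n y, ∀ d ∈ F n, dist (u n y) (u (n + 1) y) ≤ 1 / 2 ^ n * ‖y - d‖ :=
    fun n => hst2 n (v n)
  have hd3 : ∀ n, ∀ b ∈ S n \ F n, ∀ᶠ y in 𝓝 b, ‖u (n + 1) y - u (n + 1) b‖ ≤ M * ‖y - b‖ :=
    fun n => hst3 n (v n)
  obtain ⟨g, hg, hlim⟩ := limit_lemma u (fun n => (v n).2.1) (fun _ => 2) continuous_const hd
  refine ⟨g, hg, ?_, ?_, ?_⟩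
  · intro y
    have h1 : Tendsto (fun n => T (u n y)) atTop (𝓝 (T (g y))) :=
      (T.continuous.tendsto _).comp (hlim y)
    have h2 : (fun n => T (u n y)) = fun _ => y := funext fun n => (v n).2.2 y
    rw [h2] at h1
    exact (tendsto_nhds_unique h1 tendsto_const_nhds)
  · intro y
    have h1 := dist_le_of_le_geometric_two_of_tendsto₀ (fun n => hd n y) (hlim y)
    rw [u0, dist_comm, dist_eq_norm] at h1
    have h2 := norm_le_norm_add_norm_sub' (g y) (σ y)
    have := hσn y
    linarith
  · intro n b hb
    -- the first index whose net contains the point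
    have hex : ∃ k, b ∈ S k := ⟨n, hb⟩
    classical
    obtain ⟨k, hk, hkF⟩ : ∃ k, b ∈ S k ∧ b ∉ F k := by
      refine ⟨Nat.find hex, Nat.find_spec hex, ?_⟩
      simp only [F, Set.mem_iUnion, Set.mem_Iio, not_exists]
      intro j hj
      exact Nat.find_min hex hj
    have hbF : ∀ m, b ∈ F (m + (k + 1)) := by
      intro m
      simp only [F, Set.mem_iUnion, Set.mem_Iio]
      exact ⟨k, by omega, hk⟩
    have hest : ∀ y, dist (u (k + 1) y) (g y) ≤ 2 * ‖y - b‖ := by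
      intro y
      have hl : Tendsto (fun m => u (m + (k + 1)) y) atTop (𝓝 (g y)) :=
        (tendsto_add_atTop_iff_nat (f := fun m => u m y) (k + 1)).2 (hlim y)
      have := dist_le_of_le_geometric_two_of_tendsto₀ (C := 2 * ‖y - b‖)
        (f := fun m => u (m + (k + 1)) y) (fun m => ?_) hl
      · simpa using this
      · have h1 := hd2 (m + (k + 1)) y b (hbF m)
        have e : m + 1 + (k + 1) = m + (k + 1) + 1 := by omega
        rw [e]
        refine h1.trans ?_
        rw [mul_div_cancel_left₀ _ two_ne_zero, div_eq_mul_inv ‖y - b‖, mul_comm, one_div]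
        gcongr
        · norm_num
        · omega
    have hb0 : u (k + 1) b = g b := by
      have := hest b
      rw [sub_self, norm_zero, mul_zero] at this
      exact dist_le_zero.1 this
    filter_upwards [hd3 k b ⟨hk, hkF⟩] with y hy
    have h1 := hest y
    rw [dist_comm, dist_eq_norm] at h1
    rw [hb0] at hy
    have h2 := norm_sub_le_norm_sub_add_norm_sub (g y) (u (k + 1) y) (g b)
    linarith

end

lemma ptwise_of_eventually {X Y : Type*} [NormedAddCommGroup X] [NormedAddCommGroup Y]
    {f : Y → X} {η : ℝ} (hη : 0 < η) {b : Y}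
    (h : ∀ᶠ y in 𝓝 b, ‖f y - f b‖ ≤ η * ‖y - b‖) : PtwiseLipschitzAt f η b := by
  obtain ⟨ρ, hρ, hb⟩ := Metric.eventually_nhds_iff.1 h
  refine Filter.limsup_le_of_le (by isBoundedDefault) ?_
  filter_upwards [Ioo_mem_nhdsGT hρ] with r hr
  have hr0 : ENNReal.ofReal r ≠ 0 := by simpa using hr.1
  rw [mul_comm, ← div_eq_mul_inv, ENNReal.div_le_iff hr0 ENNReal.ofReal_ne_top,
    ← ENNReal.ofReal_mul hη.le]
  refine iSup₂_le fun a ha => ?_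
  rw [Metric.mem_closedBall] at ha
  rw [edist_comm, edist_dist]
  refine ENNReal.ofReal_le_ofReal ?_
  rw [dist_eq_norm]
  refine (hb (ha.trans_lt hr.2)).trans ?_
  rw [← dist_eq_norm]
  gcongr

lemma dense_meager_subset {Y : Type*} [NormedAddCommGroup Y] [NormedSpace ℝ Y] [Nontrivial Y]
    {A : Set Y} (hA : Dense A) : ∃ B ⊆ A, Dense B ∧
      ∃ s : ℕ → Set Y, (∀ n, IsNowhereDense (s n)) ∧ B ⊆ ⋃ n, s n := by
  choose S hSA hSp hSd using fun n : ℕ => exists_sep A (1 / ((n : ℝ) + 1))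
  have hpos : ∀ n : ℕ, (0 : ℝ) < 1 / ((n : ℝ) + 1) := fun n => by positivity
  refine ⟨⋃ n, S n, Set.iUnion_subset hSA, ?_, S, ?_, subset_rfl⟩
  · rw [Metric.dense_iff]
    intro x r hr
    obtain ⟨n, hn⟩ := exists_nat_one_div_lt (half_pos hr)
    obtain ⟨a, ha, haA⟩ := Metric.dense_iff.1 hA x (r / 2) (half_pos hr)
    obtain ⟨s, hs, hsd⟩ := hSd n (hpos n) a haA
    refine ⟨s, ?_, Set.mem_iUnion.2 ⟨n, hs⟩⟩
    rw [Metric.mem_ball] at *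
    have := dist_triangle s a x
    rw [dist_comm s a] at this
    linarith
  · intro n
    have hc := Metric.isClosed_of_pairwise_le_dist (hpos n) (hSp n)
    rw [hc.isNowhereDense_iff, Set.eq_empty_iff_forall_notMem]
    intro x hx
    have hxS := interior_subset hx
    have hnb : interior (S n) ∩ Metric.ball x (1 / ((n : ℝ) + 1)) ∈ 𝓝 x :=
      Filter.inter_mem (isOpen_interior.mem_nhds hx) (Metric.ball_mem_nhds _ (hpos n))
    haveI : (𝓝[≠] x).NeBot := Module.punctured_nhds_neBot ℝ Y x
    have : ∃ z ∈ interior (S n) ∩ Metric.ball x (1 / ((n : ℝ) + 1)), z ≠ x := by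
      have h1 := (mem_nhdsWithin_of_mem_nhds hnb : _ ∈ 𝓝[≠] x)
      obtain ⟨z, hz⟩ := Filter.nonempty_of_mem (Filter.inter_mem h1 self_mem_nhdsWithin)
      exact ⟨z, hz.1, hz.2⟩
    obtain ⟨z, ⟨hz1, hz2⟩, hne⟩ := this
    have h3 := hSp n (interior_subset hz1) hxS hne
    rw [Metric.mem_ball] at hz2
    linarith

/-- **Improved Bartle–Graves Theorem.** -/
theorem stmt6 {X Y : Type*} [NormedAddCommGroup X] [NormedSpace ℝ X] [CompleteSpace X]
    [NormedAddCommGroup Y] [NormedSpace ℝ Y] [CompleteSpace Y]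
    (hX : ¬ FiniteDimensional ℝ X) (hY : ¬ FiniteDimensional ℝ Y)
    (T : X →L[ℝ] Y) (hT : Function.Surjective T) :
    ∃ η : ℝ, 0 < η ∧ ∃ (τ : Y → X) (B : Set Y),
      Continuous τ ∧
      (∀ l : ℝ, 0 ≤ l → ∀ y : Y, τ (l • y) = l • τ y) ∧
      (∀ y : Y, T (τ y) = y) ∧
      Dense B ∧
      (∃ s : ℕ → Set Y, (∀ n, IsNowhereDense (s n)) ∧ B ⊆ ⋃ n, s n) ∧
      (∀ b ∈ B, PtwiseLipschitzAt τ η b) := by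
  haveI : Nontrivial Y := by
    by_contra h
    rw [not_nontrivial_iff_subsingleton] at h
    exact hY inferInstance
  obtain ⟨M, hM, σ, hσ, hσn, hσT⟩ := bartle_graves T hT
  choose S hSA hSp hSd using fun n : ℕ => exists_sep (Metric.sphere (0 : Y) 1) (1 / ((n : ℝ) + 1))
  have hpos : ∀ n : ℕ, (0 : ℝ) < 1 / ((n : ℝ) + 1) := fun n => by positivity
  obtain ⟨g, hg, hgT, hgn, hgL⟩ := main_sel T hM hσ hσn hσT S _ hpos hSp
  let τ : Y → X := fun y => ‖y‖ • g (‖y‖⁻¹ • y)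
  have hunit : ∀ y : Y, y ≠ 0 → ‖‖y‖⁻¹ • y‖ = 1 := fun y hy => by
    rw [norm_smul, norm_inv, norm_norm, inv_mul_cancel₀ (norm_ne_zero_iff.2 hy)]
  have τ0 : τ 0 = 0 := by simp [τ]
  have hgu : ∀ y : Y, y ≠ 0 → ‖g (‖y‖⁻¹ • y)‖ ≤ M + 2 := fun y hy => by
    have := hgn (‖y‖⁻¹ • y)
    rwa [hunit y hy, mul_one] at this
  have hτn : ∀ y, ‖τ y‖ ≤ (M + 2) * ‖y‖ := by
    intro y
    by_cases hy : y = 0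
    · simp [hy, τ0]
    · simp only [τ]
      rw [norm_smul, norm_norm, mul_comm]
      exact mul_le_mul_of_nonneg_right (hgu y hy) (norm_nonneg _)
  have hτc : Continuous τ := by
    rw [continuous_iff_continuousAt]
    intro y
    by_cases h : y = 0
    · subst h
      rw [ContinuousAt, τ0]
      refine squeeze_zero_norm hτn ?_
      have : Continuous fun y : Y => (M + 2) * ‖y‖ := by fun_prop
      simpa using this.tendsto 0
    · have h1 : ContinuousAt (fun y : Y => ‖y‖⁻¹ • y) y :=
        (continuous_norm.continuousAt.inv₀ (norm_ne_zero_iff.2 h)).smul continuousAt_id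
      exact continuous_norm.continuousAt.smul (hg.continuousAt.comp h1)
  have hτh : ∀ l : ℝ, 0 ≤ l → ∀ y : Y, τ (l • y) = l • τ y := by
    intro l hl y
    rcases hl.eq_or_lt with rfl | hl
    · simp [τ0]
    · have e : ‖l • y‖⁻¹ • l • y = ‖y‖⁻¹ • y := by
        rw [norm_smul, Real.norm_of_nonneg hl.le, smul_smul, mul_inv, mul_right_comm,
          inv_mul_cancel₀ hl.ne', one_mul]
      simp only [τ]
      rw [e, norm_smul, Real.norm_of_nonneg hl.le, mul_smul]
  have hτT : ∀ y, T (τ y) = y := by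
    intro y
    by_cases hy : y = 0
    · simp [hy, τ0]
    · simp only [τ]
      rw [map_smul, hgT, smul_inv_smul₀ (norm_ne_zero_iff.2 hy)]
  let A : Set Y := {b | ∀ᶠ y in 𝓝 b, ‖τ y - τ b‖ ≤ 3 * (M + 2) * ‖y - b‖}
  have h0A : (0 : Y) ∈ A := by
    refine Filter.Eventually.of_forall fun y => ?_
    rw [τ0, sub_zero, sub_zero]
    refine (hτn y).trans (mul_le_mul_of_nonneg_right (by linarith) (norm_nonneg _))
  have hlA : ∀ n, ∀ d ∈ S n, ∀ l : ℝ, 0 < l → l • d ∈ A := by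
    intro n d hd l hl
    have hdn : ‖d‖ = 1 := by simpa using hSA n hd
    have hbn : ‖l • d‖ = l := by rw [norm_smul, hdn, mul_one, Real.norm_of_nonneg hl.le]
    have hb0 : l • d ≠ 0 := by rw [← norm_ne_zero_iff, hbn]; exact hl.ne'
    have hbd : ‖l • d‖⁻¹ • l • d = d := by rw [hbn, inv_smul_smul₀ hl.ne']
    have h1 : Tendsto (fun y : Y => ‖y‖⁻¹ • y) (𝓝 (l • d)) (𝓝 d) := by
      have : ContinuousAt (fun y : Y => ‖y‖⁻¹ • y) (l • d) :=
        (continuous_norm.continuousAt.inv₀ (norm_ne_zero_iff.2 hb0)).smul continuousAt_id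
      rw [ContinuousAt, hbd] at this
      exact this
    change ∀ᶠ y in 𝓝 (l • d), _
    filter_upwards [h1.eventually (hgL n d hd), isOpen_ne.mem_nhds hb0] with y hy hy0
    have hτb : τ (l • d) = l • g d := by
      simp only [τ]; rw [hbd, hbn]
    set w := ‖y‖⁻¹ • y with hw
    have hyw : y = ‖y‖ • w := by rw [hw, smul_inv_smul₀ (norm_ne_zero_iff.2 hy0)]
    have hwn : ‖w‖ = 1 := hunit y hy0
    have hnn : |‖y‖ - l| ≤ ‖y - l • d‖ := by
      have := abs_norm_sub_norm_le y (l • d)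
      rwa [hbn] at this
    have e1 : τ y - τ (l • d) = (‖y‖ - l) • g w + l • (g w - g d) := by
      rw [hτb]
      change ‖y‖ • g w - l • g d = _
      module
    have e2 : l • (w - d) = (y - l • d) - (‖y‖ - l) • w := by
      have : y - l • d = ‖y‖ • w - l • d := by rw [← hyw]
      rw [this]
      module
    have h3 : l * ‖w - d‖ ≤ 2 * ‖y - l • d‖ := by
      have : ‖l • (w - d)‖ ≤ ‖y - l • d‖ + ‖(‖y‖ - l) • w‖ := by
        rw [e2]; exact norm_sub_le _ _
      rw [norm_smul, norm_smul, hwn, Real.norm_of_nonneg hl.le, mul_one, Real.norm_eq_abs] at this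
      linarith
    have h4 : ‖g w‖ ≤ M + 2 := hgu y hy0
    rw [e1]
    refine (norm_add_le _ _).trans ?_
    rw [norm_smul, norm_smul, Real.norm_of_nonneg hl.le, Real.norm_eq_abs]
    have h5 : |‖y‖ - l| * ‖g w‖ ≤ ‖y - l • d‖ * (M + 2) := by gcongr
    have h6 : l * ‖g w - g d‖ ≤ (M + 2) * (l * ‖w - d‖) := by
      have := mul_le_mul_of_nonneg_left hy hl.le
      linarith
    have h7 := mul_le_mul_of_nonneg_left h3 (by linarith : (0 : ℝ) ≤ M + 2)
    linarith
  have hAd : Dense A := by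
    rw [Metric.dense_iff]
    intro x ρ hρ
    by_cases hx : x = 0
    · exact ⟨0, by simpa [hx] using hρ, h0A⟩
    · have hxn : 0 < ‖x‖ := norm_pos_iff.2 hx
      obtain ⟨n, hn⟩ := exists_nat_one_div_lt (div_pos hρ hxn)
      obtain ⟨d, hd, hdd⟩ := hSd n (hpos n) (‖x‖⁻¹ • x) (by simpa using hunit x hx)
      refine ⟨‖x‖ • d, ?_, hlA n d hd _ hxn⟩
      rw [Metric.mem_ball, dist_comm]
      have e : x = ‖x‖ • (‖x‖⁻¹ • x) := by rw [smul_inv_smul₀ hxn.ne']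
      have h2 : dist x (‖x‖ • d) = ‖x‖ * dist (‖x‖⁻¹ • x) d := by
        conv_lhs => rw [e]
        rw [norm_smul, hunit x hx, norm_norm, mul_one, dist_smul₀, norm_norm]
      rw [h2]
      have := hdd.trans hn
      rw [lt_div_iff₀ hxn] at this
      linarith
  obtain ⟨B, hBA, hBd, hBm⟩ := dense_meager_subset hAd
  have hη : 0 < 3 * (M + 2) := by positivity
  exact ⟨3 * (M + 2), hη, τ, B, hτc, hτh, hτT, hBd, hBm,
    fun b hb => ptwise_of_eventually hη (hBA hb)⟩
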